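/- Let c₁ > 0 and c₂ ∈ ℝ. Define θ(s) = 2·arctan(e^{−s}), y(s) = 2·c₁·cosh(s), and z(s) = 2·(c₂ + arctan(e^s)). Then for all s ∈ ℝ: y(s) > 0, θ'(s) = −sin θ(s), y'(s) = y(s)·cos θ(s), and z'(s) = sin θ(s). -/

import Mathlib

open Real

theorem sin_two_mul_arctan_eq (x : ℝ) :
    Real.sin (2 * Real.arctan x) = 2 * x / (1 + x ^ 2) := by
  have h : 0 < 1 + x ^ 2 := by positivity
  rw [Real.sin_two_mul, Real.sin_arctan, Real.cos_arctan, mul_assoc, div_mul_div_comm,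
    Real.mul_self_sqrt h.le]
  ring

theorem cos_two_mul_arctan_eq (x : ℝ) :
    Real.cos (2 * Real.arctan x) = (1 - x ^ 2) / (1 + x ^ 2) := by
  rw [Real.cos_two_mul, Real.cos_sq_arctan]
  field_simp
  ring

/-- The generating curves of the non-trivial parabolic h-grim reapers:
    θ(s) = 2 arctan e^{−s}, y = 2c₁ cosh s, z = 2(c₂ + arctan e^s) solve
    θ' = −sin θ, y' = y cos θ, z' = sin θ. -/
theorem stmt_14 (c₁ c₂ : ℝ) (hc₁ : 0 < c₁) :
    let θ : ℝ → ℝ := fun s => 2 * Real.arctan (Real.exp (-s))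
    let y : ℝ → ℝ := fun s => 2 * c₁ * Real.cosh s
    let z : ℝ → ℝ := fun s => 2 * (c₂ + Real.arctan (Real.exp s))
    ∀ s : ℝ, 0 < y s ∧
      HasDerivAt θ (-Real.sin (θ s)) s ∧
      HasDerivAt y (y s * Real.cos (θ s)) s ∧
      HasDerivAt z (Real.sin (θ s)) s := by
  intro θ y z s
  have hsin : Real.sin (θ s) = 2 * Real.exp s / (1 + Real.exp s ^ 2) := by
    simp only [θ, sin_two_mul_arctan_eq, Real.exp_neg]
    field_simp
    ring
  have hcos : Real.cos (θ s) = (Real.exp s ^ 2 - 1) / (1 + Real.exp s ^ 2) := by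
    simp only [θ, cos_two_mul_arctan_eq, Real.exp_neg]
    field_simp
    ring
  refine ⟨mul_pos (by positivity) (Real.cosh_pos s), ?_, ?_, ?_⟩
  · refine (((hasDerivAt_neg s).exp.arctan).const_mul 2).congr_deriv ?_
    rw [show θ s = 2 * Real.arctan (Real.exp (-s)) from rfl, sin_two_mul_arctan_eq]
    ring
  · refine ((Real.hasDerivAt_cosh s).const_mul (2 * c₁)).congr_deriv ?_
    rw [hcos, show y s = 2 * c₁ * Real.cosh s from rfl, Real.cosh_eq, Real.sinh_eq, Real.exp_neg]
    field_simp
    ring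
  · refine (((Real.hasDerivAt_exp s).arctan.const_add c₂).const_mul 2).congr_deriv ?_
    rw [hsin]
    ring
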